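/- The quotient of the complex projective plane by complex conjugation is homeomorphic to the 4-sphere. Precisely: let ι : ℂP² → ℂP² be the involution induced by coordinatewise complex conjugation, ι([z₁ : z₂ : z₃]) = [conj z₁ : conj z₂ : conj z₃]. Then the quotient space of ℂP² by the equivalence relation identifying x with ι(x) for every x, equipped with the quotient topology, is homeomorphic to S⁴. -/

import Mathlib

open scoped ComplexConjugate

noncomputable section

/-- The setoid on nonzero vectors of `ℂⁿ` whose quotient is complex projective space:
two nonzero vectors are identified iff they differ by a nonzero complex scalar. -/
def projSetoid (n : ℕ) : Setoid {v : Fin n → ℂ // v ≠ 0} where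
  r v w := ∃ c : ℂ, c ≠ 0 ∧ (w : Fin n → ℂ) = c • (v : Fin n → ℂ)
  iseqv := by
    refine ⟨fun v => ⟨1, one_ne_zero, (one_smul _ _).symm⟩, ?_, ?_⟩
    · rintro v w ⟨c, hc, h⟩
      exact ⟨c⁻¹, inv_ne_zero hc, by rw [h, smul_smul, inv_mul_cancel₀ hc, one_smul]⟩
    · rintro u v w ⟨c, hc, h⟩ ⟨d, hd, h'⟩
      exact ⟨d * c, mul_ne_zero hd hc, by rw [h', h, smul_smul]⟩

/-- The complex projective plane `ℂP²`, as the quotient of `ℂ³ \ {0}` by nonzero complex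
scalar multiplication, equipped with the quotient topology. -/
abbrev CP2 : Type := Quotient (projSetoid 3)

/-- Coordinatewise complex conjugation on nonzero vectors of `ℂ³`. -/
def conjVec (v : {v : Fin 3 → ℂ // v ≠ 0}) : {v : Fin 3 → ℂ // v ≠ 0} :=
  ⟨fun i => conj (v.1 i), fun h => v.2 (funext fun i => by
    have := congrFun h i
    simpa using this)⟩

/-- The involution `ι` of `ℂP²` induced by coordinatewise complex conjugation:
`ι [z₁ : z₂ : z₃] = [conj z₁ : conj z₂ : conj z₃]`. -/
def cpConj : CP2 → CP2 :=
  Quotient.map conjVec (by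
    rintro v w ⟨c, hc, h⟩
    refine ⟨conj c, by simpa using hc, ?_⟩
    funext i
    simp [conjVec, h, Pi.smul_apply, smul_eq_mul, map_mul])

/-- The real part of the Hermitian matrix `z z*`. -/
def reG (z : Fin 3 → ℂ) (i j : Fin 3) : ℝ :=
  (z i).re * (z j).re + (z i).im * (z j).im

/-- Five coordinates of `Re (z z*)` modulo scalar matrices. -/
def pMap (z : Fin 3 → ℂ) : EuclideanSpace ℝ (Fin 5) :=
  !₂[reG z 0 1, reG z 0 2, reG z 1 2, reG z 0 0 - reG z 2 2, reG z 1 1 - reG z 2 2]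

lemma reG_symm (z : Fin 3 → ℂ) (i j : Fin 3) : reG z i j = reG z j i := by
  simp only [reG]; ring

lemma reG_smul (c : ℂ) (z : Fin 3 → ℂ) (i j : Fin 3) :
    reG (c • z) i j = Complex.normSq c * reG z i j := by
  simp [reG, Complex.normSq_apply]; ring

lemma reG_conj (v : {v : Fin 3 → ℂ // v ≠ 0}) (i j : Fin 3) :
    reG (conjVec v).1 i j = reG v.1 i j := by
  simp [reG, conjVec]

lemma pMap_smul (c : ℂ) (z : Fin 3 → ℂ) :
    pMap (c • z) = Complex.normSq c • pMap z := by
  ext i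
  fin_cases i <;> simp [pMap, reG_smul] <;> ring

lemma pMap_conj (v : {v : Fin 3 → ℂ // v ≠ 0}) : pMap (conjVec v).1 = pMap v.1 := by
  simp [pMap, reG_conj]

lemma continuous_pMap : Continuous pMap := by
  unfold pMap reG
  fun_prop

lemma exists_kernel (w : Fin 3 → ℂ) :
    ∃ v : Fin 3 → ℝ, v ≠ 0 ∧ ∑ i, v i * (w i).re = 0 ∧ ∑ i, v i * (w i).im = 0 := by
  let f : (Fin 3 → ℝ) →ₗ[ℝ] (Fin 2 → ℝ) :=
    Matrix.mulVecLin !![(w 0).re, (w 1).re, (w 2).re; (w 0).im, (w 1).im, (w 2).im]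
  have h : LinearMap.ker f ≠ ⊥ := LinearMap.ker_ne_bot_of_finrank_lt (by simp)
  obtain ⟨v, hv, hv0⟩ := (Submodule.ne_bot_iff _).1 h
  refine ⟨v, hv0, ?_, ?_⟩
  · have := congrFun (LinearMap.mem_ker.1 hv) 0
    simp [f, Matrix.mulVec, dotProduct, Fin.sum_univ_three] at this
    rw [Fin.sum_univ_three]; linarith
  · have := congrFun (LinearMap.mem_ker.1 hv) 1
    simp [f, Matrix.mulVec, dotProduct, Fin.sum_univ_three] at this
    rw [Fin.sum_univ_three]; linarith

lemma scalar_nonneg (z w : Fin 3 → ℂ) (c : ℝ)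
    (h : ∀ i j, reG z i j = reG w i j + if i = j then c else 0) : 0 ≤ c := by
  obtain ⟨v, hv0, h1, h2⟩ := exists_kernel w
  have hpos : 0 < ∑ i, v i ^ 2 := by
    obtain ⟨k, hk⟩ := Function.ne_iff.1 hv0
    exact Finset.sum_pos' (fun i _ => sq_nonneg _) ⟨k, Finset.mem_univ _, by
      have : v k ≠ 0 := hk
      positivity⟩
  have e : ∀ u : Fin 3 → ℂ, ∑ i, ∑ j, v i * v j * reG u i j =
      (∑ i, v i * (u i).re) ^ 2 + (∑ i, v i * (u i).im) ^ 2 := by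
    intro u
    simp only [Fin.sum_univ_three, reG]; ring
  have e1 := e z
  have e2 := e w
  rw [h1, h2] at e2
  have e3 : ∑ i, ∑ j, v i * v j * reG z i j =
      ∑ i, ∑ j, v i * v j * reG w i j + c * ∑ i, v i ^ 2 := by
    simp only [h, Fin.sum_univ_three]
    simp
    ring
  by_contra! hc
  nlinarith [sq_nonneg (∑ i, v i * (z i).re), sq_nonneg (∑ i, v i * (z i).im),
    mul_neg_of_neg_of_pos hc hpos]

lemma reG_eq_of_pMap_eq (z w : Fin 3 → ℂ) (h : pMap z = pMap w) (i j : Fin 3) :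
    reG z i j = reG w i j := by
  have h0 : reG z 0 1 = reG w 0 1 := by simpa [pMap] using congrArg (fun x => x 0) h
  have h1 : reG z 0 2 = reG w 0 2 := by simpa [pMap] using congrArg (fun x => x 1) h
  have h2 : reG z 1 2 = reG w 1 2 := by simpa [pMap] using congrArg (fun x => x 2) h
  have h3 : reG z 0 0 - reG z 2 2 = reG w 0 0 - reG w 2 2 := by
    simpa [pMap] using congrArg (fun x => x 3) h
  have h4 : reG z 1 1 - reG z 2 2 = reG w 1 1 - reG w 2 2 := by
    simpa [pMap] using congrArg (fun x => x 4) h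
  have h0' := h0
  have h1' := h1
  have h2' := h2
  rw [reG_symm z, reG_symm w] at h0' h1' h2'
  have key : ∀ i j, reG z i j = reG w i j + if i = j then reG z 2 2 - reG w 2 2 else 0 := by
    intro i j
    fin_cases i <;> fin_cases j <;> simp <;> linarith
  have key' : ∀ i j, reG w i j = reG z i j + if i = j then reG w 2 2 - reG z 2 2 else 0 := by
    intro i j
    rw [key i j]
    split_ifs <;> ring
  have := scalar_nonneg _ _ _ key
  have := scalar_nonneg _ _ _ key'
  rw [key i j]
  split_ifs <;> linarith

lemma rel_of_reG_eq (z w : Fin 3 → ℂ) (hz : z ≠ 0) (h : ∀ i j, reG z i j = reG w i j) :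
    ∃ c : ℂ, c ≠ 0 ∧ (w = c • z ∨ w = c • fun i => conj (z i)) := by
  obtain ⟨k, hk⟩ := Function.ne_iff.1 hz
  have hk : z k ≠ 0 := hk
  have hn : (0 : ℝ) < reG z k k := by
    have := Complex.normSq_pos.2 hk
    rwa [Complex.normSq_apply] at this
  have hwk : w k ≠ 0 := by
    intro h0
    have := h k k
    simp [reG, h0] at this
    simp [reG] at hn
    linarith
  have hck : conj (w k) ≠ 0 := by simpa using hwk
  -- imaginary parts of `z i * conj (z k)`
  set a : Fin 3 → ℝ := fun i => (z i).im * (z k).re - (z i).re * (z k).im with ha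
  set b : Fin 3 → ℝ := fun i => (w i).im * (w k).re - (w i).re * (w k).im with hb
  have hab : ∀ i j, a i * a j = b i * b j := by
    intro i j
    have e : ∀ u : Fin 3 → ℂ, ((u i).im * (u k).re - (u i).re * (u k).im) *
        ((u j).im * (u k).re - (u j).re * (u k).im) =
        reG u i j * reG u k k - reG u i k * reG u j k := by
      intro u; simp only [reG]; ring
    simp only [ha, hb, e, h]
  have hsign : (∀ i, b i = a i) ∨ (∀ i, b i = - a i) := by
    by_cases h0 : ∀ i, a i = 0
    · left
      intro i
      have := hab i i
      rw [h0 i] at this ⊢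
      nlinarith
    · push Not at h0
      obtain ⟨m, hm⟩ := h0
      rcases mul_self_eq_mul_self_iff.1 (hab m m) with h1 | h1
      · left
        intro i
        have := hab m i
        rw [← h1] at this
        exact (mul_left_cancel₀ hm this).symm
      · right
        intro i
        have := hab m i
        have h2 : b m = - a m := by linarith
        rw [h2] at this
        refine mul_left_cancel₀ hm ?_
        linarith
  rcases hsign with hs | hs
  · refine ⟨conj (z k) / conj (w k), div_ne_zero (by simpa using hk) hck, Or.inl ?_⟩
    funext i
    have h1 := h i k
    have h2 := hs i
    simp only [ha, hb, reG] at h1 h2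
    rw [Pi.smul_apply, smul_eq_mul, div_mul_eq_mul_div, eq_div_iff hck]
    apply Complex.ext <;> simp <;> linarith
  · refine ⟨z k / conj (w k), div_ne_zero hk hck, Or.inr ?_⟩
    funext i
    have h1 := h i k
    have h2 := hs i
    simp only [ha, hb, reG] at h1 h2
    rw [Pi.smul_apply, smul_eq_mul, div_mul_eq_mul_div, eq_div_iff hck]
    apply Complex.ext <;> simp <;> linarith

lemma pMap_ne_zero (z : Fin 3 → ℂ) (hz : z ≠ 0) : pMap z ≠ 0 := by
  intro h
  have h0 : pMap z = pMap 0 := by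
    rw [h]; ext i; fin_cases i <;> simp [pMap, reG]
  apply hz
  obtain ⟨c, -, hc⟩ := rel_of_reG_eq z 0 hz (reG_eq_of_pMap_eq _ _ h0)
  funext k
  have := reG_eq_of_pMap_eq _ _ h0 k k
  have h2 : Complex.normSq (z k) = 0 := by
    rw [Complex.normSq_apply]; simpa [reG] using this
  exact Complex.normSq_eq_zero.1 h2

lemma exists_reG (T : Matrix (Fin 3) (Fin 3) ℝ) (hT : T.IsHermitian) :
    ∃ (z : Fin 3 → ℂ) (c : ℝ), ∀ i j, reG z i j = T i j - if i = j then c else 0 := by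
  obtain ⟨k, hk⟩ := Finite.exists_min hT.eigenvalues
  set l := hT.eigenvalues with hl
  set U : Matrix (Fin 3) (Fin 3) ℝ := (hT.eigenvectorUnitary : Matrix (Fin 3) (Fin 3) ℝ) with hU
  have h1 : ∀ i j, T i j = ∑ m, U i m * l m * U j m := by
    intro i j
    have := congrFun (congrFun hT.spectral_theorem i) j
    rw [this, Unitary.conjStarAlgAut_apply, Matrix.mul_apply]
    simp [Matrix.mul_diagonal, Matrix.star_apply, hU, hl]
  have h2 : ∀ i j, (if i = j then (1 : ℝ) else 0) = ∑ m, U i m * U j m := by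
    intro i j
    have := congrFun (congrFun (Unitary.coe_mul_star_self hT.eigenvectorUnitary) i) j
    rw [Matrix.mul_apply, Matrix.one_apply] at this
    rw [← this]
    simp [Matrix.star_apply, hU]
  have hsum : ∀ f : Fin 3 → ℝ, ∑ m, f m = f k + f (k + 1) + f (k + 2) := by
    intro f
    rw [Fin.sum_univ_three]
    fin_cases k <;> simp <;> ring
  refine ⟨fun i => ⟨√(l (k + 1) - l k) * U i (k + 1), √(l (k + 2) - l k) * U i (k + 2)⟩, l k, ?_⟩
  intro i j
  have h3 : (if i = j then l k else 0) = l k * (if i = j then (1 : ℝ) else 0) := by simp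
  rw [h3, h2, h1, hsum, hsum]
  have s1 := Real.mul_self_sqrt (sub_nonneg.2 (hk (k + 1)))
  have s2 := Real.mul_self_sqrt (sub_nonneg.2 (hk (k + 2)))
  simp only [reG]
  linear_combination (U i (k + 1) * U j (k + 1)) * s1 + (U i (k + 2) * U j (k + 2)) * s2

lemma pMap_surjective : Function.Surjective pMap := by
  intro v
  obtain ⟨z, c, h⟩ := exists_reG !![v 3, v 0, v 1; v 0, v 4, v 2; v 1, v 2, 0] (by
    ext i j
    fin_cases i <;> fin_cases j <;> simp)
  refine ⟨z, ?_⟩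
  ext i
  fin_cases i <;> simp [pMap, h]

/-- The normalized map from nonzero vectors to the sphere. -/
def sMap (v : {v : Fin 3 → ℂ // v ≠ 0}) : Metric.sphere (0 : EuclideanSpace ℝ (Fin 5)) 1 :=
  ⟨‖pMap v.1‖⁻¹ • pMap v.1, by
    have := norm_ne_zero_iff.2 (pMap_ne_zero v.1 v.2)
    simp [norm_smul, this]⟩

lemma continuous_sMap : Continuous sMap := by
  have h : Continuous fun v : {v : Fin 3 → ℂ // v ≠ 0} => pMap v.1 :=
    continuous_pMap.comp continuous_subtype_val
  exact ((h.norm.inv₀ fun v => norm_ne_zero_iff.2 (pMap_ne_zero v.1 v.2)).smul h).subtype_mk _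

/-- The map `ℂP² → S⁴`. -/
def cpMap : CP2 → Metric.sphere (0 : EuclideanSpace ℝ (Fin 5)) 1 :=
  Quotient.lift sMap (by
    rintro v w ⟨c, hc, h⟩
    apply Subtype.ext
    have hc' : 0 < Complex.normSq c := Complex.normSq_pos.2 hc
    simp only [sMap, h, pMap_smul, norm_smul, smul_smul, Real.norm_of_nonneg hc'.le]
    congr 1
    field_simp)

/-- The map `ℂP² / conj → S⁴`. -/
def quotMap : (Quot fun x y : CP2 => y = cpConj x) →
    Metric.sphere (0 : EuclideanSpace ℝ (Fin 5)) 1 :=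
  Quot.lift cpMap (by
    rintro x y rfl
    induction x using Quotient.inductionOn with | h v =>
    apply Subtype.ext
    change ‖pMap v.1‖⁻¹ • pMap v.1 = ‖pMap (conjVec v).1‖⁻¹ • pMap (conjVec v).1
    rw [pMap_conj])

lemma continuous_quotMap : Continuous quotMap :=
  continuous_quot_lift _ (continuous_quot_lift _ continuous_sMap)

lemma quotMap_surjective : Function.Surjective quotMap := by
  intro y
  obtain ⟨z, hz⟩ := pMap_surjective y.1
  have hy : ‖y.1‖ = 1 := by simpa using y.2
  have hz0 : z ≠ 0 := by
    rintro rfl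
    have h0 : pMap 0 = 0 := by
      ext i; fin_cases i <;> simp [pMap, reG]
    rw [← hz, h0] at hy
    simp at hy
  refine ⟨Quot.mk _ (Quotient.mk _ ⟨z, hz0⟩), ?_⟩
  apply Subtype.ext
  change ‖pMap z‖⁻¹ • pMap z = _
  rw [hz, hy]; simp

lemma quotMap_injective : Function.Injective quotMap := by
  intro x y hxy
  induction x using Quot.ind with | mk x =>
  induction y using Quot.ind with | mk y =>
  induction x using Quotient.inductionOn with | h v =>
  induction y using Quotient.inductionOn with | h w =>
  have h : ‖pMap v.1‖⁻¹ • pMap v.1 = ‖pMap w.1‖⁻¹ • pMap w.1 := congrArg Subtype.val hxy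
  have hv := norm_pos_iff.2 (pMap_ne_zero v.1 v.2)
  have hw := norm_pos_iff.2 (pMap_ne_zero w.1 w.2)
  set t : ℝ := ‖pMap w.1‖ * ‖pMap v.1‖⁻¹ with ht
  have htpos : 0 < t := by positivity
  have h2 : t • pMap v.1 = pMap w.1 := by
    rw [ht, mul_smul, h, smul_smul, mul_inv_cancel₀ hw.ne', one_smul]
  have hs : ((√t : ℝ) : ℂ) ≠ 0 := by
    simpa using (Real.sqrt_pos.2 htpos).ne'
  have h3 : pMap (((√t : ℝ) : ℂ) • v.1) = pMap w.1 := by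
    rw [pMap_smul, Complex.normSq_ofReal, Real.mul_self_sqrt htpos.le, h2]
  obtain ⟨c, hc, h4 | h4⟩ := rel_of_reG_eq _ w.1 (smul_ne_zero hs v.2) (reG_eq_of_pMap_eq _ _ h3)
  · congr 1
    apply Quotient.sound
    refine ⟨c * ((√t : ℝ) : ℂ), mul_ne_zero hc hs, ?_⟩
    rw [h4, smul_smul]
  · apply Quot.sound
    symm
    apply Quotient.sound
    refine ⟨c * ((√t : ℝ) : ℂ), mul_ne_zero hc hs, ?_⟩
    rw [h4]
    funext i
    simp [conjVec, mul_assoc]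

instance compactSpace_CP2 : CompactSpace CP2 := by
  let f : Metric.sphere (0 : Fin 3 → ℂ) 1 → CP2 := fun v =>
    Quotient.mk _ ⟨v.1, by
      intro h
      have := v.2
      simp [h] at this⟩
  have hf : Continuous f := continuous_quot_mk.comp (continuous_subtype_val.subtype_mk _)
  have hs : Function.Surjective f := by
    intro x
    induction x using Quotient.inductionOn with | h v =>
    have hv : ‖v.1‖ ≠ 0 := norm_ne_zero_iff.2 v.2
    have hvc : ((‖v.1‖ : ℝ) : ℂ) ≠ 0 := by exact_mod_cast hv
    refine ⟨⟨((‖v.1‖ : ℝ) : ℂ)⁻¹ • v.1, by simp [norm_smul, hv]⟩, ?_⟩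
    apply Quotient.sound
    exact ⟨((‖v.1‖ : ℝ) : ℂ), hvc, by simp [smul_smul, hvc]⟩
  exact hs.compactSpace hf

/-- **Massey–Kuiper–Arnol'd.** The quotient of the complex projective plane by the
involution induced by coordinatewise complex conjugation, with the quotient topology,
is homeomorphic to the 4-sphere. -/
theorem cp2_quotient_complex_conjugation_homeomorph_sphere :
    Nonempty ((Quot fun x y : CP2 => y = cpConj x) ≃ₜ
      Metric.sphere (0 : EuclideanSpace ℝ (Fin 5)) 1) := by
  have : CompactSpace (Quot fun x y : CP2 => y = cpConj x) := Quot.compactSpace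
  exact ⟨continuous_quotMap.homeoOfEquivCompactToT2
    (f := Equiv.ofBijective quotMap ⟨quotMap_injective, quotMap_surjective⟩)⟩

end
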